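/- Let n be a natural number, let G be a symmetric, negative definite n×n integer matrix, and let α ∈ ℤⁿ be a characteristic vector for G that maximizes the quantity βᵀG⁻¹β over all β in the coset α + 2Gℤⁿ. Then for every index i, Gᵢᵢ ≤ αᵢ ≤ −Gᵢᵢ. -/

import Mathlib

open Matrix

/-- `α` is a characteristic vector for `G`: for every `v ∈ ℤⁿ`,
`α ⬝ᵥ v ≡ vᵀGv (mod 2)`. -/
def IsCharVec (n : ℕ) (G : Matrix (Fin n) (Fin n) ℤ) (α : Fin n → ℤ) : Prop :=
  ∀ v : Fin n → ℤ, α ⬝ᵥ v ≡ v ⬝ᵥ (G *ᵥ v) [ZMOD 2]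

/-- The rational number `αᵀ G⁻¹ α`, computed with the inverse of `G` over `ℚ`. -/
noncomputable def quadQ (n : ℕ) (G : Matrix (Fin n) (Fin n) ℤ) (α : Fin n → ℤ) : ℚ :=
  (fun i => (α i : ℚ)) ⬝ᵥ ((G.map ((↑) : ℤ → ℚ))⁻¹ *ᵥ fun i => (α i : ℚ))

/-- A rational matrix whose quadratic form is negative off zero is invertible. -/
theorem isUnit_det_of_forall_dotProduct_mulVec_neg {n : ℕ} {A : Matrix (Fin n) (Fin n) ℚ}
    (hA : ∀ v : Fin n → ℚ, v ≠ 0 → v ⬝ᵥ (A *ᵥ v) < 0) : IsUnit A.det := by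
  rw [isUnit_iff_ne_zero]
  intro hdet
  obtain ⟨v, hv, hAv⟩ := Matrix.exists_mulVec_eq_zero_iff.mpr hdet
  simpa [hAv] using hA v hv

/-- Completing the square: `(a + 2Ay)ᵀA⁻¹(a + 2Ay) = aᵀA⁻¹a + 4(aᵀy + yᵀAy)`. -/
theorem dotProduct_inv_mulVec_add_two_smul {n : ℕ} {A : Matrix (Fin n) (Fin n) ℚ}
    (hA : A.IsSymm) (hdet : IsUnit A.det) (a y : Fin n → ℚ) :
    (a + (2 : ℚ) • (A *ᵥ y)) ⬝ᵥ (A⁻¹ *ᵥ (a + (2 : ℚ) • (A *ᵥ y))) =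
      a ⬝ᵥ (A⁻¹ *ᵥ a) + 4 * (a ⬝ᵥ y + y ⬝ᵥ (A *ᵥ y)) := by
  have hinv : A⁻¹ *ᵥ (A *ᵥ y) = y := by
    rw [Matrix.mulVec_mulVec, Matrix.nonsing_inv_mul _ hdet, Matrix.one_mulVec]
  have hcross : (A *ᵥ y) ⬝ᵥ (A⁻¹ *ᵥ a) = a ⬝ᵥ y := by
    rw [← Matrix.vecMul_transpose, hA.eq, ← Matrix.dotProduct_mulVec, Matrix.mulVec_mulVec,
      Matrix.mul_nonsing_inv _ hdet, Matrix.one_mulVec, dotProduct_comm]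
  rw [Matrix.mulVec_add, Matrix.mulVec_smul, hinv]
  simp only [add_dotProduct, dotProduct_add, smul_dotProduct, dotProduct_smul, smul_eq_mul,
    hcross, dotProduct_comm (A *ᵥ y) y]
  ring

/-- Translating by `2Gx` changes `αᵀG⁻¹α` by `4(αᵀx + xᵀGx)`. -/
theorem quadQ_add_two_smul_mulVec {n : ℕ} {G : Matrix (Fin n) (Fin n) ℤ} (hG : G.IsSymm)
    (hdet : IsUnit (G.map ((↑) : ℤ → ℚ)).det) (α x : Fin n → ℤ) :
    quadQ n G (α + 2 • (G *ᵥ x)) =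
      quadQ n G α + 4 * ((α ⬝ᵥ x + x ⬝ᵥ (G *ᵥ x) : ℤ) : ℚ) := by
  have hcast : (fun i => ((α + 2 • (G *ᵥ x)) i : ℚ)) =
      (fun i => (α i : ℚ)) + (2 : ℚ) • (G.map ((↑) : ℤ → ℚ) *ᵥ fun i => (x i : ℚ)) := by
    ext i
    simp [Matrix.mulVec, dotProduct]
  rw [quadQ, hcast, dotProduct_inv_mulVec_add_two_smul (hG.map _) hdet, quadQ]
  simp [Matrix.mulVec, dotProduct]

/-- If `G` is symmetric and negative definite and the characteristic vector `α`
maximizes `βᵀG⁻¹β` over its coset `α + 2Gℤⁿ`, then `Gᵢᵢ ≤ αᵢ ≤ -Gᵢᵢ` for all `i`. -/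
theorem maximizer_coords_bounded (n : ℕ) (G : Matrix (Fin n) (Fin n) ℤ) (hG : G.IsSymm)
    (hneg : ∀ v : Fin n → ℚ, v ≠ 0 → v ⬝ᵥ ((G.map ((↑) : ℤ → ℚ)) *ᵥ v) < 0)
    (α : Fin n → ℤ) (hα : IsCharVec n G α)
    (hmax : ∀ β : Fin n → ℤ, (∃ x : Fin n → ℤ, β = α + 2 • (G *ᵥ x)) →
      quadQ n G β ≤ quadQ n G α) :
    ∀ i : Fin n, G i i ≤ α i ∧ α i ≤ -(G i i) := by
  have hdet := isUnit_det_of_forall_dotProduct_mulVec_neg hneg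
  have hle (x : Fin n → ℤ) : α ⬝ᵥ x + x ⬝ᵥ (G *ᵥ x) ≤ 0 := by
    have h := hmax _ ⟨x, rfl⟩
    rw [quadQ_add_two_smul_mulVec hG hdet] at h
    have h' : ((α ⬝ᵥ x + x ⬝ᵥ (G *ᵥ x) : ℤ) : ℚ) ≤ 0 := by linarith
    exact_mod_cast h'
  intro i
  have hpos := hle (Pi.single i 1)
  have hminus := hle (-Pi.single i 1)
  simp [Matrix.mulVec_neg] at hpos hminus
  constructor <;> linarith
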